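/- Let B be an equational system with Var(ℓ) = Var(r) for all ℓ ≈ r ∈ B, and let R be a left-linear TRS that is terminating modulo B. Then R is Church–Rosser modulo B if and only if every prime critical pair of R and every prime critical pair between R and B^± is joinable in the sense t →R* · ∼B · ←R* u. -/

import Mathlib

/-- First-order terms over a signature `F` with natural-number variables. -/
inductive Tm (F : Type) : Type
  | var : Nat → Tm F
  | fn  : F → List (Tm F) → Tm F

namespace Tm

variable {F : Type}

mutual
def subst (σ : Nat → Tm F) : Tm F → Tm F
  | .var n => σ n
  | .fn f ts => .fn f (substList σ ts)
def substList (σ : Nat → Tm F) : List (Tm F) → List (Tm F)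
  | [] => []
  | t :: ts => subst σ t :: substList σ ts
end

mutual
def varsList : Tm F → List Nat
  | .var n => [n]
  | .fn _ ts => varsListL ts
def varsListL : List (Tm F) → List Nat
  | [] => []
  | t :: ts => varsList t ++ varsListL ts
end

/-- The set of variables of a term. -/
def vars (t : Tm F) : Set Nat := {n | n ∈ varsList t}

/-- A term is linear if no variable occurs more than once. -/
def Linear (t : Tm F) : Prop := (varsList t).Nodup

/-- The subterm at a given position (if the position exists). -/
def subtermAt : Tm F → List Nat → Option (Tm F)
  | t, [] => some t
  | .var _, _ :: _ => none
  | .fn _ ts, i :: p =>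
    match ts[i]? with
    | some u => subtermAt u p
    | none => none
  termination_by t p => p.length

/-- Replacement of the subterm at a given position. -/
def replaceAt : Tm F → List Nat → Tm F → Option (Tm F)
  | _, [], s => some s
  | .var _, _ :: _, _ => none
  | .fn f ts, i :: p, s =>
    match ts[i]? with
    | some u => (replaceAt u p s).map fun u' => .fn f (ts.set i u')
    | none => none
  termination_by t p _ => p.length

end Tm

open Tm

/-- A term rewrite system (or equational system): a set of pairs of terms. -/
abbrev TRS (F : Type) := Set (Tm F × Tm F)

/-- Well-formedness of the rules: left-hand sides are not variables and
variables of right-hand sides occur on the left. -/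
def IsTRS {F : Type} (R : TRS F) : Prop :=
  ∀ p ∈ R, (∀ n, p.1 ≠ .var n) ∧ vars p.2 ⊆ vars p.1

def LeftLinear {F : Type} (R : TRS F) : Prop := ∀ p ∈ R, Linear p.1

/-- One-step rewrite relation of a set of rules (closed under contexts and
substitutions). -/
def Rew {F : Type} (R : TRS F) (s t : Tm F) : Prop :=
  ∃ p l r σ, (l, r) ∈ R ∧ subtermAt s p = some (subst σ l) ∧
    replaceAt s p (subst σ r) = some t

/-- Normal forms. -/
def NF {A : Type} (r : A → A → Prop) (a : A) : Prop := ∀ b, ¬ r a b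

/-- The equational theory `∼B` generated by an ES `B`. -/
def simE {F : Type} (B : TRS F) : Tm F → Tm F → Prop :=
  Relation.EqvGen (Rew B)

/-- Rewriting modulo: `∼B · →R · ∼B`. -/
def RewMod {F : Type} (R B : TRS F) (s t : Tm F) : Prop :=
  ∃ s' t', simE B s s' ∧ Rew R s' t' ∧ simE B t' t

def Terminating {F : Type} (R : TRS F) : Prop :=
  WellFounded (fun a b => Rew R b a)

def TerminatingMod {F : Type} (R B : TRS F) : Prop :=
  WellFounded (fun a b => RewMod R B b a)

/-- Conversion modulo `B`: arbitrary sequences of `→R`, `←R` and `∼B` steps. -/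
def ConvMod {F : Type} (R B : TRS F) : Tm F → Tm F → Prop :=
  Relation.ReflTransGen (fun a b => Rew R a b ∨ Rew R b a ∨ simE B a b)

/-- Joinability modulo `B` using the plain rewrite relation:
`→R* · ∼B · ←R*`. -/
def JoinMod {F : Type} (R B : TRS F) (s t : Tm F) : Prop :=
  ∃ u v, Relation.ReflTransGen (Rew R) s u ∧ simE B u v ∧
    Relation.ReflTransGen (Rew R) t v

def ChurchRosserMod {F : Type} (R B : TRS F) : Prop :=
  ∀ s t, ConvMod R B s t → JoinMod R B s t

def Joinable {F : Type} (R : TRS F) (s t : Tm F) : Prop :=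
  ∃ v, Relation.ReflTransGen (Rew R) s v ∧ Relation.ReflTransGen (Rew R) t v

def Confluent {F : Type} (R : TRS F) : Prop :=
  ∀ s t u, Relation.ReflTransGen (Rew R) s t → Relation.ReflTransGen (Rew R) s u →
    Joinable R t u

/-- Renaming a term by a bijection on variables. -/
def rename {F : Type} (ρ : Nat ≃ Nat) (t : Tm F) : Tm F :=
  subst (fun n => .var (ρ n)) t

def VariantTm {F : Type} (s t : Tm F) : Prop := ∃ ρ : Nat ≃ Nat, rename ρ s = t

def VariantRule {F : Type} (p q : Tm F × Tm F) : Prop :=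
  ∃ ρ : Nat ≃ Nat, rename ρ p.1 = q.1 ∧ rename ρ p.2 = q.2

def Unifies {F : Type} (σ : Nat → Tm F) (s t : Tm F) : Prop := subst σ s = subst σ t

/-- Most general unifier. -/
def IsMGU {F : Type} (σ : Nat → Tm F) (s t : Tm F) : Prop :=
  Unifies σ s t ∧ ∀ τ, Unifies τ s t → ∃ δ, ∀ n, τ n = subst δ (σ n)

/-- `CriticalPeak R₁ R₂ t p s u` : `t ←R₁[p] s →R₂[ε] u` is a critical peak
obtained from an overlap of variable-disjoint variants of rules of `R₁`
(inner rule) and `R₂` (root rule). -/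
def CriticalPeak {F : Type} (R₁ R₂ : TRS F) (t : Tm F) (p : List Nat) (s u : Tm F) :
    Prop :=
  ∃ l₁ r₁ l₂ r₂ σ,
    (∃ q ∈ R₁, VariantRule q (l₁, r₁)) ∧
    (∃ q ∈ R₂, VariantRule q (l₂, r₂)) ∧
    (vars l₁ ∪ vars r₁) ∩ (vars l₂ ∪ vars r₂) = ∅ ∧
    (∃ f ts, subtermAt l₂ p = some (.fn f ts) ∧ IsMGU σ l₁ (.fn f ts)) ∧
    (p = [] → ¬ VariantRule (l₁, r₁) (l₂, r₂)) ∧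
    s = subst σ l₂ ∧
    replaceAt s p (subst σ r₁) = some t ∧
    u = subst σ r₂

/-- The set of critical pairs between `R₁` and `R₂`. -/
def CP {F : Type} (R₁ R₂ : TRS F) : Set (Tm F × Tm F) :=
  {tu | ∃ p s, CriticalPeak R₁ R₂ tu.1 p s tu.2}

/-- A critical peak `t ←[p] s →[ε] u` is prime (w.r.t. `R`) if all proper
subterms of `s|p` are in normal form w.r.t. `→R`. -/
def PrimeAt {F : Type} (R : TRS F) (s : Tm F) (p : List Nat) : Prop :=
  ∀ q v, q ≠ [] → subtermAt s (p ++ q) = some v → NF (Rew R) v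

/-- Prime critical pairs of a TRS. -/
def PCP {F : Type} (R : TRS F) : Set (Tm F × Tm F) :=
  {tu | ∃ p s, CriticalPeak R R tu.1 p s tu.2 ∧ PrimeAt R s p}

/-- `E ∪ E⁻¹`. -/
def sympm {F : Type} (E : TRS F) : TRS F :=
  E ∪ {q | ∃ p ∈ E, q = (p.2, p.1)}

/-- Prime critical pairs between `R` and `B^±` (in both directions), where
primality is always checked with respect to `→R`. -/
def PCPpm {F : Type} (R B : TRS F) : Set (Tm F × Tm F) :=
  {tu | ∃ p s, (CriticalPeak R (sympm B) tu.1 p s tu.2 ∨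
                CriticalPeak (sympm B) R tu.1 p s tu.2) ∧ PrimeAt R s p}

/-! ### Terms and substitutions -/

namespace Tm

variable {F : Type}

theorem substList_eq_map (σ : Nat → Tm F) (ts : List (Tm F)) :
    substList σ ts = ts.map (subst σ) := by
  induction ts with
  | nil => rfl
  | cons t ts ih => simp [substList, ih]

theorem varsListL_eq_flatMap (ts : List (Tm F)) : varsListL ts = ts.flatMap varsList := by
  induction ts with
  | nil => rfl
  | cons t ts ih => simp [varsListL, ih]

@[simp] theorem subst_var (σ : Nat → Tm F) (n : Nat) : subst σ (var n) = σ n := by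
  simp [subst]

@[simp] theorem subst_fn (σ : Nat → Tm F) (f : F) (ts : List (Tm F)) :
    subst σ (fn f ts) = fn f (ts.map (subst σ)) := by
  simp [subst, substList_eq_map]

@[simp] theorem mem_vars_var {n m : Nat} : n ∈ vars (var m : Tm F) ↔ n = m := by
  simp [vars, varsList]

@[simp] theorem mem_vars_fn {n : Nat} {f : F} {ts : List (Tm F)} :
    n ∈ vars (fn f ts) ↔ ∃ t ∈ ts, n ∈ vars t := by
  simp [vars, varsList, varsListL_eq_flatMap]

theorem sizeOf_lt_of_mem_args {t : Tm F} {f : F} {ts : List (Tm F)} (h : t ∈ ts) :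
    sizeOf t < sizeOf (fn f ts) := by
  have := List.sizeOf_lt_of_mem h
  simp
  omega

/-- Structural induction on terms. -/
theorem induction_on {P : Tm F → Prop} (hv : ∀ n, P (var n))
    (hf : ∀ f ts, (∀ t ∈ ts, P t) → P (fn f ts)) : ∀ t, P t
  | var n => hv n
  | fn f ts => hf f ts fun t _ => induction_on hv hf t
  termination_by t => sizeOf t
  decreasing_by exact sizeOf_lt_of_mem_args ‹_›

theorem subst_congr {σ τ : Nat → Tm F} {t : Tm F} (h : ∀ n ∈ vars t, σ n = τ n) :
    subst σ t = subst τ t := by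
  induction t using induction_on with
  | hv n => simpa using h
  | hf f ts ih =>
    simp only [subst_fn, fn.injEq, true_and, List.map_inj_left]
    exact fun t ht => ih t ht fun n hn => h n (mem_vars_fn.2 ⟨t, ht, hn⟩)

theorem eq_of_subst_eq {σ τ : Nat → Tm F} {t : Tm F} (h : subst σ t = subst τ t) :
    ∀ n ∈ vars t, σ n = τ n := by
  induction t using induction_on with
  | hv n => simpa using h
  | hf f ts ih =>
    simp only [subst_fn, fn.injEq, true_and, List.map_inj_left] at h
    intro n hn
    obtain ⟨t, ht, hn⟩ := mem_vars_fn.1 hn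
    exact ih t ht (h t ht) n hn

@[simp] theorem subst_subst (σ τ : Nat → Tm F) (t : Tm F) :
    subst τ (subst σ t) = subst (fun n => subst τ (σ n)) t := by
  induction t using induction_on with
  | hv n => simp
  | hf f ts ih => simpa using ih

@[simp] theorem subst_var_self (t : Tm F) : subst var t = t := by
  induction t using induction_on with
  | hv n => simp
  | hf f ts ih => rw [subst_fn, List.map_congr_left ih, List.map_id']

end Tm

/-! ### Most general unifiers -/

namespace Tm

variable {F : Type}

theorem sizeOf_le_of_mem_vars (σ : Nat → Tm F) {n : Nat} {t : Tm F} (h : n ∈ vars t) :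
    sizeOf (σ n) ≤ sizeOf (subst σ t) := by
  induction t using induction_on with
  | hv m => simp [mem_vars_var.1 h]
  | hf f ts ih =>
    obtain ⟨t, ht, hn⟩ := mem_vars_fn.1 h
    have := sizeOf_lt_of_mem_args (f := f) (List.mem_map_of_mem (f := subst σ) ht)
    rw [subst_fn]
    exact (ih t ht hn).trans this.le

theorem not_mem_vars_of_subst_eq {σ : Nat → Tm F} {n : Nat} {t : Tm F} (hne : t ≠ var n)
    (h : σ n = subst σ t) : n ∉ vars t := by
  cases t with
  | var m => rintro hn; exact hne (by rw [mem_vars_var.1 hn])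
  | fn f ts =>
    intro hn
    obtain ⟨t, ht, hn⟩ := mem_vars_fn.1 hn
    have h1 := sizeOf_le_of_mem_vars σ hn
    have h2 := sizeOf_lt_of_mem_args (f := f) (List.mem_map_of_mem (f := subst σ) ht)
    rw [h, subst_fn] at h1
    omega

/-- `σ` solves every equation of `E`. -/
def UnifiesAll (σ : Nat → Tm F) (E : List (Tm F × Tm F)) : Prop :=
  ∀ e ∈ E, Unifies σ e.1 e.2

/-- `E` has a most general solution. -/
def HasMGU (E : List (Tm F × Tm F)) : Prop :=
  ∃ σ, UnifiesAll σ E ∧ ∀ τ, UnifiesAll τ E → ∃ δ, ∀ n, τ n = subst δ (σ n)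

theorem HasMGU.congr {E E' : List (Tm F × Tm F)}
    (h : ∀ σ, UnifiesAll σ E ↔ UnifiesAll σ E') (hE : HasMGU E) : HasMGU E' := by
  simpa only [HasMGU, h] using hE

theorem unifiesAll_cons {σ : Nat → Tm F} {s t : Tm F} {E : List (Tm F × Tm F)} :
    UnifiesAll σ ((s, t) :: E) ↔ Unifies σ s t ∧ UnifiesAll σ E := by
  simp [UnifiesAll]

theorem Unifies.symm {σ : Nat → Tm F} {s t : Tm F} (h : Unifies σ s t) : Unifies σ t s :=
  Eq.symm h

theorem unifiesAll_cons_swap {σ : Nat → Tm F} {s t : Tm F} {E : List (Tm F × Tm F)} :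
    UnifiesAll σ ((s, t) :: E) ↔ UnifiesAll σ ((t, s) :: E) := by
  rw [unifiesAll_cons, unifiesAll_cons]
  exact and_congr_left fun _ => ⟨Unifies.symm, Unifies.symm⟩

/-- The substitution replacing only the variable `x` by `t`. -/
def single (x : Nat) (t : Tm F) : Nat → Tm F := Function.update var x t

/-- Apply a substitution to both sides of every equation. -/
def substEqs (σ : Nat → Tm F) (E : List (Tm F × Tm F)) : List (Tm F × Tm F) :=
  E.map fun e => (subst σ e.1, subst σ e.2)

theorem subst_single_eq_self {x : Nat} {t u : Tm F} (h : x ∉ vars u) :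
    subst (single x t) u = u := by
  refine (subst_congr fun n hn => ?_).trans (subst_var_self u)
  exact Function.update_of_ne (by rintro rfl; exact h hn) _ _

theorem subst_single_apply {τ : Nat → Tm F} {x : Nat} {t : Tm F} (h : τ x = subst τ t) (n : Nat) :
    subst τ (single x t n) = τ n := by
  by_cases hn : n = x
  · subst hn; simp [single, h]
  · simp [single, hn]

theorem subst_comp_single {τ : Nat → Tm F} {x : Nat} {t : Tm F} (h : τ x = subst τ t)
    (u : Tm F) : subst τ (subst (single x t) u) = subst τ u := by
  rw [subst_subst]
  exact subst_congr fun n _ => subst_single_apply h n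

theorem unifiesAll_substEqs {σ τ : Nat → Tm F} {E : List (Tm F × Tm F)} :
    UnifiesAll τ (substEqs σ E) ↔ UnifiesAll (fun n => subst τ (σ n)) E := by
  simp only [UnifiesAll, substEqs, List.forall_mem_map, Unifies, subst_subst]

theorem UnifiesAll.substEqs_single {τ : Nat → Tm F} {x : Nat} {t : Tm F} {E : List (Tm F × Tm F)}
    (h : τ x = subst τ t) (hE : UnifiesAll τ E) : UnifiesAll τ (substEqs (single x t) E) := by
  rw [unifiesAll_substEqs]
  simpa only [subst_single_apply h] using hE

theorem HasMGU.eliminate {x : Nat} {t : Tm F} {E : List (Tm F × Tm F)} (hx : x ∉ vars t)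
    (h : HasMGU (substEqs (single x t) E)) : HasMGU ((var x, t) :: E) := by
  obtain ⟨σ, hσ, hmg⟩ := h
  refine ⟨fun n => subst σ (single x t n), unifiesAll_cons.2 ⟨?_, unifiesAll_substEqs.1 hσ⟩, ?_⟩
  · have := subst_single_eq_self (t := t) hx
    simp only [Unifies, subst_var]
    rw [← subst_subst, this]
    simp [single]
  · intro τ hτ
    obtain ⟨hxt, hE⟩ := unifiesAll_cons.1 hτ
    have hxt : τ x = subst τ t := by simpa [Unifies] using hxt
    obtain ⟨δ, hδ⟩ := hmg τ (hE.substEqs_single hxt)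
    refine ⟨δ, fun n => ?_⟩
    rw [← subst_single_apply hxt n, subst_subst]
    exact subst_congr fun m _ => hδ m

/-- Total size of the solved left-hand sides, the measure for unification. -/
noncomputable def solvedSize (τ : Nat → Tm F) (E : List (Tm F × Tm F)) : Nat :=
  (E.map fun e => sizeOf (subst τ e.1)).sum

theorem solvedSize_substEqs {τ : Nat → Tm F} {x : Nat} {t : Tm F} (h : τ x = subst τ t)
    (E : List (Tm F × Tm F)) : solvedSize τ (substEqs (single x t) E) = solvedSize τ E := by
  simp only [solvedSize, substEqs, List.map_map]
  congr 1
  refine List.map_congr_left fun e _ => ?_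
  simp only [Function.comp, subst_comp_single h]

theorem solvedSize_zip_le (τ : Nat → Tm F) :
    ∀ ss ts : List (Tm F), solvedSize τ (ss.zip ts) ≤ sizeOf (ss.map (subst τ))
  | [], _ => by simp [solvedSize]
  | _ :: _, [] => by simp [solvedSize]
  | s :: ss, t :: ts => by
    have := solvedSize_zip_le τ ss ts
    simp [solvedSize] at this ⊢
    omega

theorem map_eq_map_iff_unifiesAll_zip (τ : Nat → Tm F) :
    ∀ {ss ts : List (Tm F)}, ss.length = ts.length →
      (ss.map (subst τ) = ts.map (subst τ) ↔ UnifiesAll τ (ss.zip ts))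
  | [], [], _ => by simp [UnifiesAll]
  | s :: ss, t :: ts, h => by
    rw [List.zip_cons_cons, unifiesAll_cons,
      ← map_eq_map_iff_unifiesAll_zip τ (by simpa using h)]
    simp [Unifies]

theorem sizeOf_pos (t : Tm F) : 0 < sizeOf t := by
  cases t <;> simp

theorem hasMGU_of_unifiesAll {τ : Nat → Tm F} :
    ∀ {E : List (Tm F × Tm F)}, UnifiesAll τ E → HasMGU E
  | [], _ => ⟨var, by simp [UnifiesAll], fun σ _ => ⟨σ, by simp⟩⟩
  | (s, t) :: E, h => by
    obtain ⟨hst, hE⟩ := unifiesAll_cons.1 h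
    have hpos : solvedSize τ E < solvedSize τ ((s, t) :: E) := by
      have := sizeOf_pos (subst τ s)
      simp [solvedSize]; omega
    by_cases hne : s = t
    · refine (hasMGU_of_unifiesAll hE).congr fun σ => ?_
      simp [unifiesAll_cons, hne, Unifies]
    match s, t with
    | var x, t =>
      have hxt : τ x = subst τ t := by simpa [Unifies] using hst
      have := solvedSize_substEqs hxt E
      exact HasMGU.eliminate (not_mem_vars_of_subst_eq (Ne.symm hne) hxt)
        (hasMGU_of_unifiesAll (hE.substEqs_single hxt))
    | fn f ss, var x =>
      have hxt : τ x = subst τ (fn f ss) := by simpa [Unifies] using hst.symm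
      have := solvedSize_substEqs hxt E
      exact (HasMGU.eliminate (not_mem_vars_of_subst_eq hne hxt)
        (hasMGU_of_unifiesAll (hE.substEqs_single hxt))).congr fun _ => unifiesAll_cons_swap
    | fn f ss, fn g ts =>
      have hst' : f = g ∧ ss.map (subst τ) = ts.map (subst τ) := by simpa [Unifies] using hst
      have hlen : ss.length = ts.length := by simpa using congrArg List.length hst'.2
      have key : ∀ σ, UnifiesAll σ (ss.zip ts ++ E) ↔
          UnifiesAll σ ((fn f ss, fn g ts) :: E) := by
        intro σ
        rw [unifiesAll_cons, Unifies, subst_fn, subst_fn, fn.injEq,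
          map_eq_map_iff_unifiesAll_zip σ hlen]
        simp only [hst'.1, true_and]
        simp only [UnifiesAll, List.forall_mem_append]
      have hsize : solvedSize τ (ss.zip ts ++ E) < solvedSize τ ((fn f ss, fn g ts) :: E) := by
        have := solvedSize_zip_le τ ss ts
        simp [solvedSize] at this ⊢
        omega
      exact (hasMGU_of_unifiesAll ((key τ).2 h)).congr key
  termination_by E => solvedSize τ E
  decreasing_by all_goals omega

theorem exists_isMGU {τ : Nat → Tm F} {s t : Tm F} (h : Unifies τ s t) :
    ∃ σ, IsMGU σ s t := by
  have : UnifiesAll τ [(s, t)] := by simpa [UnifiesAll] using h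
  simpa [HasMGU, UnifiesAll, IsMGU] using hasMGU_of_unifiesAll this

end Tm

/-! ### Replacement of subterms -/

namespace Tm

variable {F : Type}

/-- `Replaces p s a t b`: the subterm of `s` at position `p` is `a`, and `t` results from
replacing it by `b`. -/
inductive Replaces : List Nat → Tm F → Tm F → Tm F → Tm F → Prop
  | nil (a b : Tm F) : Replaces [] a a b b
  | cons {i : Nat} {p : List Nat} {f : F} {ts : List (Tm F)} {u a u' b : Tm F} :
      ts[i]? = some u → Replaces p u a u' b →
      Replaces (i :: p) (fn f ts) a (fn f (ts.set i u')) b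

@[simp] theorem subtermAt_nil (t : Tm F) : subtermAt t [] = some t := by
  cases t <;> simp [subtermAt]

@[simp] theorem replaceAt_nil (t s : Tm F) : replaceAt t [] s = some s := by
  cases t <;> simp [replaceAt]

@[simp] theorem subtermAt_var_cons (n i : Nat) (p : List Nat) :
    subtermAt (var n : Tm F) (i :: p) = none := by
  simp [subtermAt]

theorem subtermAt_fn_cons (f : F) (ts : List (Tm F)) (i : Nat) (p : List Nat) :
    subtermAt (fn f ts) (i :: p) = ts[i]?.bind fun u => subtermAt u p := by
  rw [subtermAt]
  cases ts[i]? <;> rfl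

theorem replaceAt_fn_cons (f : F) (ts : List (Tm F)) (i : Nat) (p : List Nat) (s : Tm F) :
    replaceAt (fn f ts) (i :: p) s =
      ts[i]?.bind fun u => (replaceAt u p s).map fun u' => fn f (ts.set i u') := by
  rw [replaceAt]
  cases ts[i]? <;> rfl

theorem replaces_iff {p : List Nat} {s a t b : Tm F} :
    Replaces p s a t b ↔ subtermAt s p = some a ∧ replaceAt s p b = some t := by
  constructor
  · intro h
    induction h with
    | nil => simp
    | cons h _ ih => simp [subtermAt_fn_cons, replaceAt_fn_cons, h, ih]
  · rintro ⟨h1, h2⟩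
    induction p generalizing s t with
    | nil =>
      simp only [subtermAt_nil, replaceAt_nil, Option.some.injEq] at h1 h2
      subst h1 h2
      exact .nil _ _
    | cons i p ih =>
      cases s with
      | var n => simp at h1
      | fn f ts =>
        rw [subtermAt_fn_cons, Option.bind_eq_some_iff] at h1
        obtain ⟨u, hu, h1⟩ := h1
        simp only [replaceAt_fn_cons, hu, Option.bind_some, Option.map_eq_some_iff] at h2
        obtain ⟨u', h2, rfl⟩ := h2
        exact .cons hu (ih h1 h2)

theorem exists_replaces {p : List Nat} {s a : Tm F} (h : subtermAt s p = some a) (b : Tm F) :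
    ∃ t, Replaces p s a t b := by
  induction p generalizing s with
  | nil =>
    simp only [subtermAt_nil, Option.some.injEq] at h
    subst h
    exact ⟨b, .nil _ _⟩
  | cons i p ih =>
    cases s with
    | var n => simp at h
    | fn f ts =>
      rw [subtermAt_fn_cons, Option.bind_eq_some_iff] at h
      obtain ⟨u, hu, h⟩ := h
      obtain ⟨u', h⟩ := ih h
      exact ⟨_, .cons hu h⟩

theorem subtermAt_append (s : Tm F) (p q : List Nat) :
    subtermAt s (p ++ q) = (subtermAt s p).bind fun u => subtermAt u q := by
  induction p generalizing s with
  | nil => simp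
  | cons i p ih =>
    cases s with
    | var n => simp
    | fn f ts =>
      simp only [List.cons_append, subtermAt_fn_cons, Option.bind_assoc, ih]

theorem sizeOf_subtermAt_lt {s a : Tm F} {p : List Nat} (hp : p ≠ [])
    (h : subtermAt s p = some a) : sizeOf a < sizeOf s := by
  induction p generalizing s with
  | nil => exact absurd rfl hp
  | cons i p ih =>
    cases s with
    | var n => simp at h
    | fn f ts =>
      rw [subtermAt_fn_cons, Option.bind_eq_some_iff] at h
      obtain ⟨u, hu, h⟩ := h
      have hlt := sizeOf_lt_of_mem_args (f := f) (List.mem_of_getElem? hu)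
      by_cases hp : p = []
      · simp only [hp, subtermAt_nil, Option.some.injEq] at h
        rwa [← h]
      · exact (ih hp h).trans hlt

theorem subtermAt_subst {s a : Tm F} {p : List Nat} (σ : Nat → Tm F)
    (h : subtermAt s p = some a) : subtermAt (subst σ s) p = some (subst σ a) := by
  induction p generalizing s with
  | nil => simp_all
  | cons i p ih =>
    cases s with
    | var n => simp at h
    | fn f ts =>
      rw [subtermAt_fn_cons, Option.bind_eq_some_iff] at h
      obtain ⟨u, hu, h⟩ := h
      simp [subtermAt_fn_cons, hu, ih h]

namespace Replaces

theorem subtermAt_eq {p : List Nat} {s a t b : Tm F} (h : Replaces p s a t b) :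
    subtermAt s p = some a := (replaces_iff.1 h).1

theorem unique {p : List Nat} {s a a' t t' b : Tm F} (h : Replaces p s a t b)
    (h' : Replaces p s a' t' b) : t = t' :=
  Option.some.inj ((replaces_iff.1 h).2.symm.trans (replaces_iff.1 h').2)

theorem symm {p : List Nat} {s a t b : Tm F} (h : Replaces p s a t b) : Replaces p t b s a := by
  induction h with
  | nil => exact .nil _ _
  | @cons i p f ts u a u' b hu _ ih =>
    obtain ⟨hi, rfl⟩ := List.getElem?_eq_some_iff.1 hu
    have := cons (f := f) (ts := ts.set i u') (i := i) (by simp [hi]) ih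
    simpa using this

theorem trans {p : List Nat} {s a t b u c : Tm F} (h : Replaces p s a t b)
    (h' : Replaces p t b u c) : Replaces p s a u c := by
  induction h generalizing u with
  | nil =>
    cases h'
    exact .nil _ _
  | @cons i p f ts v a v' b hv _ ih =>
    obtain ⟨hi, rfl⟩ := List.getElem?_eq_some_iff.1 hv
    cases h' with
    | cons hw h' =>
      rw [List.getElem?_set_self hi, Option.some.injEq] at hw
      subst hw
      rw [List.set_set]
      exact .cons hv (ih h')

theorem append {p q : List Nat} {s a t b c d : Tm F} (h : Replaces p s a t b)
    (h' : Replaces q a c b d) : Replaces (p ++ q) s c t d := by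
  induction h with
  | nil => exact h'
  | cons hu _ ih => exact .cons hu (ih h')

theorem subst {p : List Nat} {s a t b : Tm F} (σ : Nat → Tm F) (h : Replaces p s a t b) :
    Replaces p (subst σ s) (subst σ a) (subst σ t) (subst σ b) := by
  induction h with
  | nil => exact .nil _ _
  | cons hu _ ih =>
    simp only [subst_fn, List.map_set]
    exact .cons (by simp [hu]) ih

end Replaces

/-- A position of an instance `subst σ l` is a function position of `l` or lies in the part
introduced by `σ`. -/
theorem subtermAt_subst_cases {σ : Nat → Tm F} {l a : Tm F} {p : List Nat}
    (h : subtermAt (subst σ l) p = some a) :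
    (∃ f ts, subtermAt l p = some (fn f ts)) ∨
      ∃ p₁ p₂ x, p = p₁ ++ p₂ ∧ subtermAt l p₁ = some (var x) ∧
        subtermAt (σ x) p₂ = some a := by
  induction p generalizing l with
  | nil =>
    cases l with
    | var n => exact .inr ⟨[], [], n, by simpa using h⟩
    | fn f ts => exact .inl ⟨f, ts, by simp⟩
  | cons i p ih =>
    cases l with
    | var n => exact .inr ⟨[], i :: p, n, by simpa using h⟩
    | fn f ts =>
      simp only [subst_fn, subtermAt_fn_cons, List.getElem?_map, Option.bind_eq_some_iff,
        Option.map_eq_some_iff] at h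
      obtain ⟨_, ⟨u, hu, rfl⟩, h⟩ := h
      rcases ih h with ⟨g, us, h⟩ | ⟨p₁, p₂, x, rfl, h1, h2⟩
      · exact .inl ⟨g, us, by simp [subtermAt_fn_cons, hu, h]⟩
      · exact .inr ⟨i :: p₁, p₂, x, rfl, by simp [subtermAt_fn_cons, hu, h1], h2⟩

theorem linear_of_mem {f : F} {ts : List (Tm F)} (h : Linear (fn f ts)) {t : Tm F} (ht : t ∈ ts) :
    Linear t := by
  simp only [Linear, varsList, varsListL_eq_flatMap, List.nodup_flatMap] at h
  exact h.1 t ht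

theorem not_mem_vars_of_linear {f : F} {ts : List (Tm F)} (h : Linear (fn f ts)) {i j : Nat}
    (hij : i ≠ j) {t u : Tm F} (ht : ts[i]? = some t) (hu : ts[j]? = some u) {x : Nat}
    (hx : x ∈ vars t) : x ∉ vars u := by
  simp only [Linear, varsList, varsListL_eq_flatMap, List.nodup_flatMap] at h
  have hp := List.pairwise_iff_getElem.1 h.2
  obtain ⟨hi, rfl⟩ := List.getElem?_eq_some_iff.1 ht
  obtain ⟨hj, rfl⟩ := List.getElem?_eq_some_iff.1 hu
  intro hx'
  rcases lt_or_gt_of_ne hij with hlt | hlt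
  · exact hp i j hi hj hlt hx hx'
  · exact hp j i hj hi hlt hx' hx

theorem mem_vars_of_subtermAt {l : Tm F} {p : List Nat} {x : Nat}
    (h : subtermAt l p = some (var x)) : x ∈ vars l := by
  induction p generalizing l with
  | nil => simp_all
  | cons i p ih =>
    cases l with
    | var n => simp at h
    | fn f ts =>
      rw [subtermAt_fn_cons, Option.bind_eq_some_iff] at h
      obtain ⟨u, hu, h⟩ := h
      exact mem_vars_fn.2 ⟨u, List.mem_of_getElem? hu, ih h⟩

/-- In an instance of a linear term, replacing below the unique occurrence of a variable
amounts to changing the substitution. -/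
theorem Replaces.eq_subst_update {l : Tm F} {σ : Nat → Tm F} {p : List Nat} {x : Nat}
    {a t w : Tm F} (hl : Linear l) (hx : subtermAt l p = some (var x))
    (h : Replaces p (Tm.subst σ l) a t w) : t = Tm.subst (Function.update σ x w) l := by
  induction p generalizing l t with
  | nil =>
    simp only [subtermAt_nil, Option.some.injEq] at hx
    subst hx
    cases h
    simp
  | cons i p ih =>
    cases l with
    | var n => simp at hx
    | fn f ts =>
      rw [subtermAt_fn_cons, Option.bind_eq_some_iff] at hx
      obtain ⟨u, hu, hx⟩ := hx
      rw [subst_fn] at h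
      cases h with
      | cons hu' h =>
        rw [List.getElem?_map, hu, Option.map_some, Option.some.injEq] at hu'
        subst hu'
        rw [ih (linear_of_mem hl (List.mem_of_getElem? hu)) hx h, subst_fn, fn.injEq]
        refine ⟨rfl, List.ext_getElem? fun j => ?_⟩
        by_cases hij : i = j
        · subst hij
          obtain ⟨hi, rfl⟩ := List.getElem?_eq_some_iff.1 hu
          simp [hi]
        · rw [List.getElem?_set_ne hij, List.getElem?_map, List.getElem?_map]
          cases hj : ts[j]? with
          | none => rfl
          | some v =>
            have := not_mem_vars_of_linear hl hij hu hj (mem_vars_of_subtermAt hx)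
            simp only [Option.map_some, Option.some.injEq]
            exact subst_congr fun n hn =>
              (Function.update_of_ne (by rintro rfl; exact this hn) _ _).symm

end Tm

/-! ### Rewriting, equivalence and joinability modulo -/

section Rewriting

variable {F : Type} {R B S S₁ S₂ : TRS F}

/-- A rewrite step at the root. -/
def RootStep (S : TRS F) (a b : Tm F) : Prop :=
  ∃ l r σ, (l, r) ∈ S ∧ a = subst σ l ∧ b = subst σ r

theorem rew_iff {s t : Tm F} :
    Rew S s t ↔ ∃ p a b, Replaces p s a t b ∧ RootStep S a b := by
  constructor
  · rintro ⟨p, l, r, σ, h, h1, h2⟩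
    exact ⟨p, _, _, replaces_iff.2 ⟨h1, h2⟩, l, r, σ, h, rfl, rfl⟩
  · rintro ⟨p, _, _, h, l, r, σ, hlr, rfl, rfl⟩
    exact ⟨p, l, r, σ, hlr, replaces_iff.1 h⟩

theorem RootStep.rew {a b : Tm F} (h : RootStep S a b) : Rew S a b :=
  rew_iff.2 ⟨[], a, b, .nil _ _, h⟩

theorem Rew.subst {s t : Tm F} (δ : Nat → Tm F) (h : Rew S s t) :
    Rew S (subst δ s) (subst δ t) := by
  obtain ⟨p, a, b, h, hr⟩ := rew_iff.1 h
  obtain ⟨l, r, σ, hlr, rfl, rfl⟩ := hr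
  exact rew_iff.2 ⟨p, _, _, h.subst δ, l, r, fun n => Tm.subst δ (σ n), hlr, by simp, by simp⟩

theorem Rew.replaces {p : List Nat} {s a t b : Tm F} (h : Replaces p s a t b) (hr : Rew S a b) :
    Rew S s t := by
  obtain ⟨q, c, d, h', hr⟩ := rew_iff.1 hr
  exact rew_iff.2 ⟨p ++ q, c, d, h.append h', hr⟩

theorem RootStep.swap {a b : Tm F} (h : RootStep (sympm B) a b) :
    RootStep B a b ∨ RootStep B b a := by
  obtain ⟨l, r, σ, hlr | ⟨q, hq, hlr⟩, rfl, rfl⟩ := h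
  · exact .inl ⟨l, r, σ, hlr, rfl, rfl⟩
  · obtain ⟨rfl, rfl⟩ := Prod.mk.inj hlr
    exact .inr ⟨q.1, q.2, σ, hq, rfl, rfl⟩

theorem rew_sympm_iff {s t : Tm F} : Rew (sympm B) s t ↔ Rew B s t ∨ Rew B t s := by
  constructor
  · intro h
    obtain ⟨p, a, b, h, hr⟩ := rew_iff.1 h
    rcases hr.swap with hr | hr
    · exact .inl (hr.rew.replaces h)
    · exact .inr (hr.rew.replaces h.symm)
  · rintro (h | h) <;> obtain ⟨p, a, b, h, l, r, σ, hlr, rfl, rfl⟩ := rew_iff.1 h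
    · exact rew_iff.2 ⟨p, _, _, h, l, r, σ, .inl hlr, rfl, rfl⟩
    · exact rew_iff.2 ⟨p, _, _, h.symm, r, l, σ, .inr ⟨_, hlr, rfl⟩, rfl, rfl⟩

theorem simE_of_rew_sympm {s t : Tm F} (h : Rew (sympm B) s t) : simE B s t := by
  rcases rew_sympm_iff.1 h with h | h
  · exact .rel _ _ h
  · exact .symm _ _ (.rel _ _ h)

theorem simE_eq_reflTransGen : simE B = Relation.ReflTransGen (Rew (sympm B)) := by
  rw [simE, ← Relation.EqvGen.reflTransGen_symmGen]
  congr 1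
  funext s t
  exact propext rew_sympm_iff.symm

theorem simE_equivalence : Equivalence (simE B) := Relation.EqvGen.is_equivalence _

theorem simE.map {g : Tm F → Tm F} (hg : ∀ s t, Rew B s t → Rew B (g s) (g t)) {s t : Tm F}
    (h : simE B s t) : simE B (g s) (g t) := by
  induction h with
  | rel _ _ h => exact .rel _ _ (hg _ _ h)
  | refl _ => exact .refl _
  | symm _ _ _ ih => exact .symm _ _ ih
  | trans _ _ _ _ _ ih1 ih2 => exact .trans _ _ _ ih1 ih2

/-- Every position of a term determines a context, viewed as a function plugging in terms. -/
theorem exists_context {p : List Nat} {s a : Tm F} (h : subtermAt s p = some a) :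
    ∃ C : Tm F → Tm F, (∀ t b, Replaces p s a t b → C b = t) ∧
      (∀ b, Replaces p s a (C b) b) ∧
      ∀ (S : TRS F) (b c : Tm F), Rew S b c → Rew S (C b) (C c) := by
  choose C hC using exists_replaces h
  exact ⟨C, fun t b hb => (hC b).unique hb, hC,
    fun S b c hbc => hbc.replaces ((hC b).symm.trans (hC c))⟩

theorem JoinMod.refl (s : Tm F) : JoinMod R B s s := ⟨s, s, .refl, .refl _, .refl⟩

theorem JoinMod.symm {s t : Tm F} : JoinMod R B s t → JoinMod R B t s
  | ⟨u, v, hu, h, hv⟩ => ⟨v, u, hv, .symm _ _ h, hu⟩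

theorem JoinMod.map {g : Tm F → Tm F} (hg : ∀ S s t, Rew S s t → Rew S (g s) (g t))
    {s t : Tm F} : JoinMod R B s t → JoinMod R B (g s) (g t)
  | ⟨u, v, hu, h, hv⟩ =>
    ⟨g u, g v, hu.lift g (hg R), h.map (hg B), hv.lift g (hg R)⟩

/-! ### Rewriting inside the substitution part -/

theorem reflTransGen_fn {f : F} : ∀ {ts us : List (Tm F)},
    List.Forall₂ (Relation.ReflTransGen (Rew S)) ts us →
      Relation.ReflTransGen (Rew S) (fn f ts) (fn f us) := by
  suffices h : ∀ {ts us : List (Tm F)}, List.Forall₂ (Relation.ReflTransGen (Rew S)) ts us →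
      ∀ pre, Relation.ReflTransGen (Rew S) (fn f (pre ++ ts)) (fn f (pre ++ us)) from
    fun {_ _} hts => h hts []
  intro ts us h
  induction h with
  | nil => exact fun _ => .refl
  | @cons t u ts us htu _ ih =>
    intro pre
    refine Relation.ReflTransGen.trans (b := fn f (pre ++ u :: ts)) ?_ ?_
    · refine htu.lift (fun v => fn f (pre ++ v :: ts)) fun v w hvw => ?_
      have : Replaces [pre.length] (fn f (pre ++ v :: ts)) v
          (fn f ((pre ++ v :: ts).set pre.length w)) w := .cons (by simp) (.nil _ _)
      simpa using hvw.replaces this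
    · simpa using ih (pre ++ [u])

theorem reflTransGen_subst {σ τ : Nat → Tm F}
    (h : ∀ n, Relation.ReflTransGen (Rew S) (σ n) (τ n)) (t : Tm F) :
    Relation.ReflTransGen (Rew S) (subst σ t) (subst τ t) := by
  induction t using induction_on with
  | hv n => simpa using h n
  | hf f ts ih =>
    rw [subst_fn, subst_fn]
    refine reflTransGen_fn ?_
    rw [List.forall₂_map_left_iff, List.forall₂_map_right_iff, List.forall₂_same]
    exact ih

theorem simE_subst {σ τ : Nat → Tm F} (h : ∀ n, simE B (σ n) (τ n)) (t : Tm F) :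
    simE B (subst σ t) (subst τ t) := by
  rw [simE_eq_reflTransGen] at h ⊢
  exact reflTransGen_subst h t

theorem reflTransGen_update_apply {σ : Nat → Tm F} {x : Nat} {w : Tm F} (hw : Rew S (σ x) w)
    (n : Nat) :
    Relation.ReflTransGen (Rew S) (σ n) (Function.update σ x w n) := by
  by_cases hn : n = x
  · subst hn
    simpa using .single hw
  · simpa [hn] using .refl

/-- After rewriting one occurrence of the instance of a variable, the remaining ones can be
rewritten in the same way. -/
theorem Tm.Replaces.reflTransGen_update {l : Tm F} {σ : Nat → Tm F} {p : List Nat} {x : Nat}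
    {a t w : Tm F} (hw : Rew S (σ x) w) (hx : subtermAt l p = some (var x))
    (h : Replaces p (Tm.subst σ l) a t w) :
    Relation.ReflTransGen (Rew S) t (Tm.subst (Function.update σ x w) l) := by
  induction p generalizing l t with
  | nil =>
    simp only [subtermAt_nil, Option.some.injEq] at hx
    subst hx
    cases h
    simpa using .refl
  | cons i p ih =>
    cases l with
    | var n => simp at hx
    | fn f ts =>
      rw [subtermAt_fn_cons, Option.bind_eq_some_iff] at hx
      obtain ⟨u, hu, hx⟩ := hx
      rw [subst_fn] at h
      cases h with
      | @cons _ _ _ _ v _ v' _ hu' h =>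
        rw [List.getElem?_map, hu, Option.map_some, Option.some.injEq] at hu'
        subst hu'
        have hv := ih hx h
        rw [subst_fn]
        refine reflTransGen_fn (List.forall₂_iff_get.2 ⟨by simp, fun j h1 h2 => ?_⟩)
        simp only [List.get_eq_getElem, List.getElem_map, List.getElem_set]
        split
        · next hij =>
          subst hij
          obtain ⟨_, rfl⟩ := List.getElem?_eq_some_iff.1 hu
          exact hv
        · exact reflTransGen_subst (reflTransGen_update_apply hw) _

end Rewriting

/-! ### Critical peaks -/

section CriticalPeaks

variable {F : Type} {R B S S₁ S₂ : TRS F}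

theorem exists_vars_bound (l₁ r₁ l₂ r₂ : Tm F) :
    ∃ N, ∀ n, n ∈ vars l₁ ∨ n ∈ vars r₁ ∨ n ∈ vars l₂ ∨ n ∈ vars r₂ → n < N := by
  have hfin : ∀ t : Tm F, (vars t).Finite := fun t => List.finite_toSet (varsList t)
  obtain ⟨M, hM⟩ := ((hfin l₁).union ((hfin r₁).union ((hfin l₂).union (hfin r₂)))).bddAbove
  exact ⟨M + 1, fun n hn => Nat.lt_succ_of_le (hM hn)⟩

theorem exists_perm_add (N : Nat) : ∃ ρ : Nat ≃ Nat, ∀ n < N, ρ n = n + N := by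
  have hinv : Function.Involutive fun n =>
      if n < N then n + N else if n < 2 * N then n - N else n := by
    intro n
    dsimp only
    split_ifs <;> omega
  exact ⟨hinv.toPerm, fun n hn => by simp [hn]⟩

theorem rename_def (ρ : Nat ≃ Nat) (t : Tm F) : rename ρ t = subst (fun n => .var (ρ n)) t := rfl

theorem exists_of_mem_vars_rename {ρ : Nat ≃ Nat} {t : Tm F} {m : Nat}
    (h : m ∈ vars (rename ρ t)) : ∃ n ∈ vars t, m = ρ n := by
  induction t using induction_on with
  | hv n => exact ⟨n, by simp, by simpa [rename_def] using h⟩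
  | hf f ts ih =>
    simp only [rename_def, subst_fn, mem_vars_fn, List.mem_map] at h
    obtain ⟨_, ⟨t, ht, rfl⟩, h⟩ := h
    obtain ⟨n, hn, rfl⟩ := ih t ht h
    exact ⟨n, mem_vars_fn.2 ⟨t, ht, hn⟩, rfl⟩

theorem mem_vars_rename {ρ : Nat ≃ Nat} {t : Tm F} {n : Nat}
    (h : n ∈ vars t) : ρ n ∈ vars (rename ρ t) := by
  induction t using induction_on with
  | hv m => simpa [rename_def] using h
  | hf f ts ih =>
    obtain ⟨t, ht, h⟩ := mem_vars_fn.1 h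
    simp only [rename_def, subst_fn, mem_vars_fn, List.mem_map]
    exact ⟨_, ⟨t, ht, rfl⟩, ih t ht h⟩

theorem VariantRule.refl (q : Tm F × Tm F) : VariantRule q q :=
  ⟨Equiv.refl _, subst_var_self _, subst_var_self _⟩

theorem VariantRule.rootStep {q : Tm F × Tm F} {l r : Tm F} (hq : q ∈ S)
    (h : VariantRule q (l, r)) (σ : Nat → Tm F) : RootStep S (subst σ l) (subst σ r) := by
  obtain ⟨ρ, rfl, rfl⟩ := h
  exact ⟨q.1, q.2, fun n => σ (ρ n), hq, by simp [rename_def], by simp [rename_def]⟩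

theorem CriticalPeak.rew {t s u : Tm F} {p : List Nat} (h : CriticalPeak S₁ S₂ t p s u) :
    Rew S₁ s t ∧ Rew S₂ s u := by
  obtain ⟨l₁, r₁, l₂, r₂, σ, ⟨q₁, hq₁, hv₁⟩, ⟨q₂, hq₂, hv₂⟩, -, ⟨f, ts, hf, hσ, -⟩, -, rfl, ht,
    rfl⟩ := h
  refine ⟨?_, (hv₂.rootStep hq₂ σ).rew⟩
  have := replaces_iff.2 ⟨subtermAt_subst σ hf, ht⟩
  rw [← hσ] at this
  exact (hv₁.rootStep hq₁ σ).rew.replaces this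

/-- An overlap of two root steps at a function position is an instance of a critical peak,
unless both reducts coincide. -/
theorem exists_criticalPeak {l₁ r₁ l₂ r₂ t : Tm F} {σ₁ σ₂ : Nat → Tm F} {p : List Nat} {f : F}
    {ts : List (Tm F)} (h₁ : (l₁, r₁) ∈ S₁) (h₂ : (l₂, r₂) ∈ S₂) (hvars : vars r₁ ⊆ vars l₁)
    (hf : subtermAt l₂ p = some (fn f ts))
    (h : Replaces p (subst σ₂ l₂) (subst σ₁ l₁) t (subst σ₁ r₁)) :
    t = subst σ₂ r₂ ∨ ∃ t₀ s₀ u₀ δ, CriticalPeak S₁ S₂ t₀ p s₀ u₀ ∧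
      subst δ t₀ = t ∧ subst δ s₀ = subst σ₂ l₂ ∧ subst δ u₀ = subst σ₂ r₂ := by
  obtain ⟨N, hN⟩ := exists_vars_bound l₁ r₁ l₂ r₂
  obtain ⟨ρ, hρ⟩ := exists_perm_add N
  let τ : Nat → Tm F := fun n => if n < N then σ₂ n else σ₁ (ρ.symm n)
  have hτ₂ : ∀ {u : Tm F}, (∀ n ∈ vars u, n < N) → subst τ u = subst σ₂ u := fun hu =>
    subst_congr fun n hn => if_pos (hu n hn)
  have hτ₁ : ∀ {u : Tm F}, (∀ n ∈ vars u, n < N) → subst τ (rename ρ u) = subst σ₁ u := by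
    intro u hu
    rw [rename_def, subst_subst]
    refine subst_congr fun n hn => ?_
    have : ¬ ρ n < N := by rw [hρ n (hu n hn)]; omega
    simp [τ, this]
  have hl₁ := hτ₁ (u := l₁) fun n hn => hN n (.inl hn)
  have hr₁ := hτ₁ (u := r₁) fun n hn => hN n (.inr (.inl hn))
  have hl₂ := hτ₂ (u := l₂) fun n hn => hN n (.inr (.inr (.inl hn)))
  have hr₂ := hτ₂ (u := r₂) fun n hn => hN n (.inr (.inr (.inr hn)))
  have hunif : Unifies τ (rename ρ l₁) (fn f ts) := by
    have h1 := subtermAt_subst τ hf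
    rw [hl₂, h.subtermAt_eq, Option.some.injEq] at h1
    rw [Unifies, hl₁, h1]
  obtain ⟨σ, hσ⟩ := exists_isMGU hunif
  obtain ⟨δ, hδ⟩ := hσ.2 τ hunif
  have hδ' : ∀ u, subst δ (subst σ u) = subst τ u := fun u => by
    rw [subst_subst]
    exact subst_congr fun n _ => (hδ n).symm
  by_cases hvar : p = [] ∧ VariantRule (rename ρ l₁, rename ρ r₁) (l₂, r₂)
  · left
    obtain ⟨rfl, π, hπl, hπr⟩ := hvar
    dsimp only at hπl hπr
    have key : subst τ (rename π (rename ρ l₁)) = subst τ (rename ρ l₁) := by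
      rw [hπl, hl₂, hl₁]
      simpa using h.subtermAt_eq
    rw [rename_def π, subst_subst] at key
    have ht : t = subst σ₁ r₁ := by simpa using (replaces_iff.1 h).2.symm
    rw [ht, ← hr₂, ← hr₁, ← hπr, rename_def π, subst_subst]
    refine subst_congr fun n hn => ?_
    obtain ⟨m, hm, rfl⟩ := exists_of_mem_vars_rename hn
    exact (eq_of_subst_eq key _ (mem_vars_rename (hvars hm))).symm
  · right
    obtain ⟨t₀, ht₀⟩ := exists_replaces (subtermAt_subst σ hf) (subst σ (rename ρ r₁))
    refine ⟨t₀, _, _, δ, ⟨rename ρ l₁, rename ρ r₁, l₂, r₂, σ, ⟨_, h₁, ρ, rfl, rfl⟩,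
      ⟨_, h₂, .refl _⟩, ?_, ⟨f, ts, hf, hσ⟩, fun hp hv => hvar ⟨hp, hv⟩, rfl,
      (replaces_iff.1 ht₀).2, rfl⟩, ?_, by rw [hδ', hl₂], by rw [hδ', hr₂]⟩
    · rw [Set.eq_empty_iff_forall_notMem]
      rintro n ⟨hn₁, hn₂⟩
      have hlt : n < N := hN n (.inr (.inr hn₂))
      obtain ⟨m, hm, rfl⟩ : ∃ m, (m ∈ vars l₁ ∨ m ∈ vars r₁) ∧ n = ρ m := by
        rcases hn₁ with hn | hn <;> obtain ⟨m, hm, rfl⟩ := exists_of_mem_vars_rename hn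
        exacts [⟨m, .inl hm, rfl⟩, ⟨m, .inr hm, rfl⟩]
      rw [hρ m (hN m (by tauto))] at hlt
      omega
    · have := ht₀.subst δ
      rw [hδ', hδ', hδ', hl₂, hr₁] at this
      exact this.unique h

theorem PrimeAt.of_subst {s : Tm F} {p : List Nat} {δ : Nat → Tm F}
    (h : PrimeAt R (subst δ s) p) : PrimeAt R s p :=
  fun q _ hq hv _ hw => h q _ hq (subtermAt_subst δ hv) _ (hw.subst δ)

theorem JoinMod.subst {s t : Tm F} (δ : Nat → Tm F) :
    JoinMod R B s t → JoinMod R B (subst δ s) (subst δ t) :=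
  JoinMod.map fun _ _ _ => Rew.subst δ

/-- Every peak of an `S₁`-step at a prime position below a root step of `S₂` is joinable. -/
def PrimePeaksJoin (R B S₁ S₂ : TRS F) : Prop :=
  ∀ s t u a b p, Replaces p s a t b → RootStep S₁ a b → RootStep S₂ s u → PrimeAt R s p →
    JoinMod R B t u

/-- Prime peaks are joinable if prime critical peaks are and if the peaks whose lower step takes
place below a variable of the upper rule are. -/
theorem primePeaksJoin_of_variable
    (hvars : ∀ q ∈ S₁, vars q.2 ⊆ vars q.1)
    (hcp : ∀ t p s u, CriticalPeak S₁ S₂ t p s u → PrimeAt R s p → JoinMod R B t u)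
    (hvar : ∀ l r σ p x a t w, (l, r) ∈ S₂ → Rew S₁ (σ x) w → subtermAt l p = some (var x) →
      Replaces p (subst σ l) a t w → JoinMod R B t (subst σ r)) :
    PrimePeaksJoin R B S₁ S₂ := by
  rintro _ t _ _ _ p h ⟨l₁, r₁, σ₁, h₁, rfl, rfl⟩ ⟨l₂, r₂, σ₂, h₂, rfl, rfl⟩ hprime
  rcases subtermAt_subst_cases h.subtermAt_eq with ⟨f, ts, hf⟩ | ⟨p₁, p₂, x, rfl, hx, hp₂⟩
  · rcases exists_criticalPeak h₁ h₂ (hvars _ h₁) hf h with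
      rfl | ⟨t₀, s₀, u₀, δ, hpeak, rfl, hs, hu⟩
    · exact .refl _
    · rw [← hs] at hprime
      rw [← hu]
      exact (hcp _ _ _ _ hpeak hprime.of_subst).subst δ
  · obtain ⟨w, hw⟩ := exists_replaces hp₂ (subst σ₁ r₁)
    obtain ⟨t', ht'⟩ := exists_replaces (subtermAt_subst σ₂ hx) w
    have : t' = t := (ht'.append (by simpa using hw)).unique h
    subst this
    have hstep : RootStep S₁ (subst σ₁ l₁) (subst σ₁ r₁) := ⟨_, _, _, h₁, rfl, rfl⟩
    exact hvar l₂ r₂ σ₂ p₁ x _ _ w h₂ (hstep.rew.replaces hw) hx ht'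

/-- A rewrite step below a variable of a rule of `S` commutes with a root step in `S`. -/
theorem joinMod_of_rew_variable (hS : S = R ∨ S = sympm B) {l r : Tm F} {σ : Nat → Tm F}
    {p : List Nat} {x : Nat} {a t w : Tm F} (hlr : (l, r) ∈ S) (hw : Rew R (σ x) w)
    (hx : subtermAt l p = some (var x)) (h : Replaces p (subst σ l) a t w) :
    JoinMod R B t (subst σ r) := by
  have ht := h.reflTransGen_update hw hx
  have hu := reflTransGen_subst (reflTransGen_update_apply hw) r
  have hstep : Rew S (subst (Function.update σ x w) l) (subst (Function.update σ x w) r) :=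
    RootStep.rew ⟨_, _, _, hlr, rfl, rfl⟩
  rcases hS with rfl | rfl
  · exact ⟨_, _, ht.tail hstep, .refl _, hu⟩
  · exact ⟨_, _, ht, simE_of_rew_sympm hstep, hu⟩

/-- An equational step below a variable of a left-linear rule commutes with a root step. -/
theorem joinMod_of_simE_variable {l r : Tm F} {σ : Nat → Tm F} {p : List Nat} {x : Nat}
    {a t w : Tm F} (hlr : (l, r) ∈ R) (hl : Linear l) (hw : Rew (sympm B) (σ x) w)
    (hx : subtermAt l p = some (var x)) (h : Replaces p (subst σ l) a t w) :
    JoinMod R B t (subst σ r) := by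
  rw [h.eq_subst_update hl hx]
  refine ⟨_, _, .single (RootStep.rew ⟨_, _, _, hlr, rfl, rfl⟩), ?_, .refl⟩
  refine simE_subst (fun n => ?_) r
  have hn := reflTransGen_update_apply hw n
  rw [← simE_eq_reflTransGen] at hn
  exact .symm _ _ hn

end CriticalPeaks

/-! ### Local peaks -/

section LocalPeaks

variable {F : Type} {R B S S₁ S₂ : TRS F}

/-- `t` and `u` are joinable, or connected by two joins through a reduct of `s`. -/
def JoinBelow (R B : TRS F) (s t u : Tm F) : Prop :=
  ∃ v, (v = t ∨ Rew R s v) ∧ JoinMod R B t v ∧ JoinMod R B v u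

theorem JoinMod.joinBelow {s t u : Tm F} (h : JoinMod R B t u) : JoinBelow R B s t u :=
  ⟨t, .inl rfl, .refl _, h⟩

theorem JoinBelow.map {g : Tm F → Tm F} (hg : ∀ S s t, Rew S s t → Rew S (g s) (g t))
    {s t u : Tm F} : JoinBelow R B s t u → JoinBelow R B (g s) (g t) (g u)
  | ⟨v, hv, htv, hvu⟩ =>
    ⟨g v, hv.imp (congrArg g) (hg _ _ _), htv.map hg, hvu.map hg⟩

theorem JoinBelow.symm {s t u : Tm F} : JoinBelow R B s t u → JoinBelow R B s u t
  | ⟨_, .inl rfl, _, h⟩ => h.symm.joinBelow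
  | ⟨v, .inr hv, htv, hvu⟩ => ⟨v, .inr hv, hvu.symm, htv.symm⟩

/-- A reducible term has an innermost redex. -/
theorem exists_innermost_rootStep {s t : Tm F} (h : Rew R s t) :
    ∃ p a b, subtermAt s p = some a ∧ RootStep R a b ∧ PrimeAt R s p := by
  by_cases hs : PrimeAt R s []
  · obtain ⟨p, a, b, hp, hab⟩ := rew_iff.1 h
    by_cases hnil : p = []
    · exact ⟨p, a, b, hp.subtermAt_eq, hab, hnil ▸ hs⟩
    · exact absurd hab.rew (hs p a hnil (by simpa using hp.subtermAt_eq) b)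
  · simp only [PrimeAt, NF, not_forall, not_not] at hs
    obtain ⟨q, v, hq, hv, w, hw⟩ := hs
    rw [List.nil_append] at hv
    have := sizeOf_subtermAt_lt hq hv
    obtain ⟨p, a, b, hp, hab, hprime⟩ := exists_innermost_rootStep hw
    refine ⟨q ++ p, a, b, by simp [subtermAt_append, hv, hp], hab, fun p' u hp' hu => ?_⟩
    refine hprime p' u hp' ?_
    simpa [subtermAt_append, hv] using hu
  termination_by sizeOf s

theorem PrimePeaksJoin.joinBelow (h : PrimePeaksJoin R B S₁ S₂) (h₁ : PrimePeaksJoin R B R S₁)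
    (h₂ : PrimePeaksJoin R B R S₂) {s t u : Tm F} (hst : Rew S₁ s t) (hsu : RootStep S₂ s u) :
    JoinBelow R B s t u := by
  obtain ⟨p, a, b, hp, hab⟩ := rew_iff.1 hst
  by_cases hprime : PrimeAt R s p
  · exact (h _ _ _ _ _ _ hp hab hsu hprime).joinBelow
  · simp only [PrimeAt, NF, not_forall, not_not] at hprime
    obtain ⟨q, v, hq, hv, w, hw⟩ := hprime
    obtain ⟨q', c, d, hc, hcd, hprime⟩ := exists_innermost_rootStep hw
    have hv' : subtermAt a q = some v := by simpa [subtermAt_append, hp.subtermAt_eq] using hv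
    have hc' : subtermAt a (q ++ q') = some c := by simp [subtermAt_append, hv', hc]
    have hprime₁ : PrimeAt R a (q ++ q') := fun p' e hp' he =>
      hprime p' e hp' (by simpa [subtermAt_append, hv', hc] using he)
    have hprime₂ : PrimeAt R s (p ++ (q ++ q')) := fun p' e hp' he =>
      hprime₁ p' e hp' (by simpa [subtermAt_append, hp.subtermAt_eq] using he)
    obtain ⟨C, hC, hC', hCrew⟩ := exists_context hp.subtermAt_eq
    obtain ⟨a', ha'⟩ := exists_replaces hc' d
    have hsa' : Replaces (p ++ (q ++ q')) s c (C a') d := (hC' a').append ha'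
    refine ⟨C a', .inr (hcd.rew.replaces hsa'), ?_, h₂ _ _ _ _ _ _ hsa' hcd hsu hprime₂⟩
    rw [← hC t b hp]
    exact ((h₁ _ _ _ _ _ _ ha' hcd hab hprime₁).map hCrew).symm

theorem joinBelow_of_rew (hR : PrimePeaksJoin R B R R) (hS : PrimePeaksJoin R B R S)
    (hS' : PrimePeaksJoin R B S R) (hSR : S = R ∨ S = sympm B) {s t u : Tm F}
    (hst : Rew R s t) (hsu : Rew S s u) : JoinBelow R B s t u := by
  obtain ⟨p, a, b, hp, hab⟩ := rew_iff.1 hst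
  obtain ⟨q, c, d, hq, hcd⟩ := rew_iff.1 hsu
  induction p generalizing s t u q with
  | nil =>
    cases hp
    exact (hS'.joinBelow hS hR hsu hab).symm
  | cons i p ih =>
    cases q with
    | nil =>
      cases hq
      exact hS.joinBelow hR hS hst hcd
    | cons j q =>
      cases hp with
      | @cons _ _ f ts v _ v' _ hv hp =>
      cases hq with
      | @cons _ _ _ _ w _ w' _ hw hq =>
      by_cases hij : i = j
      · subst hij
        obtain rfl : v = w := Option.some.inj (hv.symm.trans hw)
        have := ih (hab.rew.replaces hp) (hcd.rew.replaces hq) hp q hq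
        obtain ⟨hi, rfl⟩ := List.getElem?_eq_some_iff.1 hv
        have hctx : ∀ S x y, Rew S x y → Rew S (fn f (ts.set i x)) (fn f (ts.set i y)) := by
          intro S x y hxy
          have : Replaces [i] (fn f (ts.set i x)) x (fn f ((ts.set i x).set i y)) y :=
            .cons (by simp [hi]) (.nil _ _)
          simpa using hxy.replaces this
        simpa using this.map (g := fun x => fn f (ts.set i x)) hctx
      · have h1 : Rew S (fn f (ts.set i v')) (fn f ((ts.set i v').set j w')) :=
          hcd.rew.replaces (.cons (by rwa [List.getElem?_set_ne hij]) hq)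
        have h2 : Rew R (fn f (ts.set j w')) (fn f ((ts.set j w').set i v')) :=
          hab.rew.replaces (.cons (by rwa [List.getElem?_set_ne (Ne.symm hij)]) hp)
        rw [List.set_comm _ _ (Ne.symm hij)] at h2
        refine JoinMod.joinBelow ?_
        rcases hSR with rfl | rfl
        · exact ⟨_, _, .single h1, .refl _, .single h2⟩
        · exact ⟨_, _, .refl, simE_of_rew_sympm h1, .single h2⟩

end LocalPeaks

/-! ### From local peaks to the Church–Rosser property -/

section Abstract

variable {F : Type} {R B : TRS F}

/-- `n` is an `R`-normal form of `s`. -/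
def IsNormalFormOf (R : TRS F) (n s : Tm F) : Prop :=
  Relation.ReflTransGen (Rew R) s n ∧ NF (Rew R) n

theorem TerminatingMod.exists_isNormalFormOf (h : TerminatingMod R B) (s : Tm F) :
    ∃ n, IsNormalFormOf R n s := by
  induction s using h.induction with
  | h s ih =>
    by_cases hs : NF (Rew R) s
    · exact ⟨s, .refl, hs⟩
    · simp only [NF, not_forall, not_not] at hs
      obtain ⟨t, ht⟩ := hs
      obtain ⟨n, hn, hnf⟩ := ih t ⟨s, t, .refl _, ht, .refl _⟩
      exact ⟨n, .head ht hn, hnf⟩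

/-- Normal forms of terms equivalent to `s` are equivalent. -/
def UniqueNFAt (R B : TRS F) (s : Tm F) : Prop :=
  ∀ t n m, simE B s t → IsNormalFormOf R n s → IsNormalFormOf R m t → simE B n m

theorem JoinMod.exists_isNormalFormOf (hterm : TerminatingMod R B) {s t : Tm F}
    (h : JoinMod R B s t)
    (hs : ∀ u, Relation.ReflTransGen (Rew R) s u → UniqueNFAt R B u) :
    ∃ n m, IsNormalFormOf R n s ∧ IsNormalFormOf R m t ∧ simE B n m := by
  obtain ⟨u, v, hu, huv, hv⟩ := h
  obtain ⟨n, hn⟩ := hterm.exists_isNormalFormOf u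
  obtain ⟨m, hm⟩ := hterm.exists_isNormalFormOf v
  exact ⟨n, m, ⟨hu.trans hn.1, hn.2⟩, ⟨hv.trans hm.1, hm.2⟩, hs u hu v n m huv hn hm⟩

theorem IsNormalFormOf.simE_of_self {s n m : Tm F} (h : UniqueNFAt R B s)
    (hn : IsNormalFormOf R n s) (hm : IsNormalFormOf R m s) : simE B n m :=
  h s n m (.refl _) hn hm

/-- Joins below `s` provide equivalent normal forms of both ends. -/
theorem JoinBelow.exists_isNormalFormOf (hterm : TerminatingMod R B) {s t u : Tm F}
    (hst : Rew R s t) (h : JoinBelow R B s t u)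
    (hs : ∀ v, Relation.TransGen (Rew R) s v → UniqueNFAt R B v) :
    ∃ n m, IsNormalFormOf R n t ∧ IsNormalFormOf R m u ∧ simE B n m := by
  obtain ⟨v, hv, htv, hvu⟩ := h
  have hsv : Rew R s v := by
    rcases hv with rfl | hv
    exacts [hst, hv]
  have hv' : ∀ w, Relation.ReflTransGen (Rew R) v w → UniqueNFAt R B w :=
    fun w hw => hs w (.head' hsv hw)
  obtain ⟨m₁, n, hm₁, hn, h1⟩ := htv.symm.exists_isNormalFormOf hterm hv'
  obtain ⟨m₂, m, hm₂, hm, h2⟩ := hvu.exists_isNormalFormOf hterm hv'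
  exact ⟨n, m, hn, hm, .trans _ _ _ (.symm _ _ h1)
    (.trans _ _ _ (hm₁.simE_of_self (hv' v .refl) hm₂) h2)⟩

theorem TransGen.rewMod {s t u : Tm F} (hs : simE B s t) (h : Relation.TransGen (Rew R) t u) :
    Relation.TransGen (RewMod R B) s u := by
  induction h with
  | single h => exact .single ⟨_, _, hs, h, .refl _⟩
  | tail _ h ih => exact ih.tail ⟨_, _, .refl _, h, .refl _⟩

theorem uniqueNFAt_of_joinBelow (hterm : TerminatingMod R B)
    (hR : ∀ s t u, Rew R s t → Rew R s u → JoinBelow R B s t u)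
    (hB : ∀ s t u, Rew R s t → Rew (sympm B) s u → JoinBelow R B s t u) (s : Tm F) :
    UniqueNFAt R B s := by
  have hwf : WellFounded (Relation.TransGen fun a b => RewMod R B b a) := hterm.transGen
  induction s using hwf.induction with
  | h M ih =>
  have hbelow : ∀ s, simE B M s → ∀ v, Relation.TransGen (Rew R) s v → UniqueNFAt R B v :=
    fun s hs v hv => ih v (Relation.transGen_swap.2 (TransGen.rewMod hs hv))
  have hsame : ∀ s n m, simE B M s → IsNormalFormOf R n s → IsNormalFormOf R m s →
      simE B n m := by
    intro s n m hs hn hm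
    rcases hn.1.cases_head with rfl | ⟨t, hst, htn⟩
    · rcases hm.1.cases_head with rfl | ⟨u, hsu, -⟩
      exacts [.refl _, absurd hsu (hn.2 u)]
    · rcases hm.1.cases_head with rfl | ⟨u, hsu, hum⟩
      · exact absurd hst (hm.2 t)
      · obtain ⟨n', m', hn', hm', h⟩ :=
          (hR s t u hst hsu).exists_isNormalFormOf hterm hst (hbelow s hs)
        have h1 := IsNormalFormOf.simE_of_self (hbelow s hs t (.single hst)) ⟨htn, hn.2⟩ hn'
        have h2 := IsNormalFormOf.simE_of_self (hbelow s hs u (.single hsu)) hm' ⟨hum, hm.2⟩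
        exact .trans _ _ _ h1 (.trans _ _ _ h h2)
  have hcliff : ∀ s t n m, simE B M s → Rew (sympm B) s t → IsNormalFormOf R n s →
      IsNormalFormOf R m t → ¬ NF (Rew R) s → simE B n m := by
    intro s t n m hs hst hn hm hred
    simp only [NF, not_forall, not_not] at hred
    obtain ⟨u, hsu⟩ := hred
    obtain ⟨n', m', hn', hm', h⟩ :=
      (hB s u t hsu hst).exists_isNormalFormOf hterm hsu (hbelow s hs)
    have ht := simE_equivalence.trans hs (simE_of_rew_sympm hst)
    exact .trans _ _ _ (hsame s n n' hs hn ⟨.head hsu hn'.1, hn'.2⟩)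
      (.trans _ _ _ h (hsame t m' m ht hm' hm))
  suffices key : ∀ s t, simE B s t → simE B M s →
      ∀ n m, IsNormalFormOf R n s → IsNormalFormOf R m t → simE B n m from
    fun t n m hMt => key M t hMt (.refl _) n m
  intro s t hst
  induction hst with
  | refl s => exact fun hs n m => hsame s n m hs
  | symm s t hst ih =>
    intro ht n m hn hm
    exact .symm _ _ (ih (simE_equivalence.trans ht (.symm _ _ hst)) m n hm hn)
  | trans s t u hst _ ih₁ ih₂ =>
    intro hs n m hn hm
    obtain ⟨k, hk⟩ := hterm.exists_isNormalFormOf t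
    exact .trans _ _ _ (ih₁ hs n k hn hk) (ih₂ (simE_equivalence.trans hs hst) k m hk hm)
  | rel s t hst =>
    intro hs n m hn hm
    have ht : simE B M t := simE_equivalence.trans hs (.rel _ _ hst)
    by_cases hs' : NF (Rew R) s
    · by_cases ht' : NF (Rew R) t
      · rcases hn.1.cases_head with rfl | ⟨u, hu, -⟩
        · rcases hm.1.cases_head with rfl | ⟨u, hu, -⟩
          exacts [.rel _ _ hst, absurd hu (ht' u)]
        · exact absurd hu (hs' u)
      · exact .symm _ _ (hcliff t s m n ht (rew_sympm_iff.2 (.inr hst)) hm hn ht')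
    · exact hcliff s t n m hs (rew_sympm_iff.2 (.inl hst)) hn hm hs'

theorem churchRosserMod_of_uniqueNFAt (hterm : TerminatingMod R B)
    (h : ∀ s, UniqueNFAt R B s) : ChurchRosserMod R B := by
  intro s t hst
  suffices key : ∀ n m, IsNormalFormOf R n s → IsNormalFormOf R m t → simE B n m by
    obtain ⟨n, hn⟩ := hterm.exists_isNormalFormOf s
    obtain ⟨m, hm⟩ := hterm.exists_isNormalFormOf t
    exact ⟨n, m, hn.1, key n m hn hm, hm.1⟩
  induction hst with
  | refl => exact fun n m => IsNormalFormOf.simE_of_self (h s)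
  | @tail t u _ htu ih =>
    intro n m hn hm
    obtain ⟨k, hk⟩ := hterm.exists_isNormalFormOf t
    refine .trans _ _ _ (ih n k hn hk) ?_
    rcases htu with htu | htu | htu
    · exact hk.simE_of_self (h t) ⟨.head htu hm.1, hm.2⟩
    · exact IsNormalFormOf.simE_of_self (h u) ⟨.head htu hk.1, hk.2⟩ hm
    · exact h t u k m htu hk hm

end Abstract

/-- A left-linear TRS terminating modulo `B` is Church–Rosser modulo `B`
iff all prime critical pairs of `R` and all prime critical pairs between `R`
and `B^±` are joinable in the sense `→R* · ∼B · ←R*`. -/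
theorem stmt5 {F : Type} (R B : TRS F) (hTRS : IsTRS R) (hll : LeftLinear R)
    (hB : ∀ p ∈ B, vars p.1 = vars p.2)
    (hterm : TerminatingMod R B) :
    ChurchRosserMod R B ↔
      ((∀ tu ∈ PCP R, JoinMod R B tu.1 tu.2) ∧
       (∀ tu ∈ PCPpm R B, JoinMod R B tu.1 tu.2)) := by
  constructor
  · intro hCR
    have hconv : ∀ {s t u}, simE B s t ∨ Rew R s t → simE B s u ∨ Rew R s u →
        JoinMod R B t u := by
      refine fun {s t u} ht hu => hCR _ _ (.tail (.single (b := s) ?_) ?_)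
      · exact ht.elim (fun h => .inr (.inr (.symm _ _ h))) fun h => .inr (.inl h)
      · exact hu.elim (fun h => .inr (.inr h)) .inl
    refine ⟨?_, ?_⟩
    · rintro ⟨t, u⟩ ⟨p, s, h, -⟩
      exact hconv (.inr h.rew.1) (.inr h.rew.2)
    · rintro ⟨t, u⟩ ⟨p, s, h | h, -⟩
      · exact hconv (.inr h.rew.1) (.inl (simE_of_rew_sympm h.rew.2))
      · exact hconv (.inl (simE_of_rew_sympm h.rew.1)) (.inr h.rew.2)
  · rintro ⟨hPCP, hPCPpm⟩
    have hvarsR : ∀ q ∈ R, vars q.2 ⊆ vars q.1 := fun q hq => (hTRS q hq).2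
    have hvarsB : ∀ q ∈ sympm B, vars q.2 ⊆ vars q.1 := by
      rintro q (hq | ⟨q, hq, rfl⟩)
      exacts [(hB q hq).superset, (hB q hq).subset]
    have hRR : PrimePeaksJoin R B R R := primePeaksJoin_of_variable hvarsR
      (fun t p s u h hp => hPCP (t, u) ⟨p, s, h, hp⟩)
      fun _ _ _ _ _ _ _ _ hlr hw hx h => joinMod_of_rew_variable (.inl rfl) hlr hw hx h
    have hRB : PrimePeaksJoin R B R (sympm B) := primePeaksJoin_of_variable hvarsR
      (fun t p s u h hp => hPCPpm (t, u) ⟨p, s, .inl h, hp⟩)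
      fun _ _ _ _ _ _ _ _ hlr hw hx h => joinMod_of_rew_variable (.inr rfl) hlr hw hx h
    have hBR : PrimePeaksJoin R B (sympm B) R := primePeaksJoin_of_variable hvarsB
      (fun t p s u h hp => hPCPpm (t, u) ⟨p, s, .inr h, hp⟩)
      fun _ _ _ _ _ _ _ _ hlr hw hx h => joinMod_of_simE_variable hlr (hll _ hlr) hw hx h
    exact churchRosserMod_of_uniqueNFAt hterm <| uniqueNFAt_of_joinBelow hterm
      (fun _ _ _ => joinBelow_of_rew hRR hRR hRR (.inl rfl))
      fun _ _ _ => joinBelow_of_rew hRR hRB hBR (.inr rfl)
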